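/- Let g1 and g2 be metrics on an open set U ⊆ ℝ^N such that at every point u ∈ U the matrix v(u) = g1(u) · g2(u)⁻¹ has N pairwise distinct real eigenvalues (a non-singular pair of metrics). If the Nijenhuis tensor of the affinor v^i_j(u) = Σ_s g1^{is}(u) (g2)_{sj}(u) vanishes identically on U, then g1 and g2 are compatible. In particular, a non-singular pair of metrics is compatible if and only if it is almost compatible. -/

import Mathlib

open Matrix

/-- Partial derivative `∂f/∂u^j` of a scalar function on `ℝ^N`. -/
noncomputable def pd {N : ℕ} (f : (Fin N → ℝ) → ℝ) (j : Fin N) (u : Fin N → ℝ) : ℝ :=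
  fderiv ℝ f u (Pi.single j 1)

/-- Matrix-valued fields on `ℝ^N` (contravariant metrics, affinors, ...). -/
abbrev MetF (N : ℕ) := (Fin N → ℝ) → Matrix (Fin N) (Fin N) ℝ

/-- `g` is a contravariant metric on `U`: smooth, symmetric and invertible there. -/
def IsMetricOn {N : ℕ} (g : MetF N) (U : Set (Fin N → ℝ)) : Prop :=
  (∀ i j, ContDiffOn ℝ (⊤ : ℕ∞) (fun u => g u i j) U) ∧
  (∀ u ∈ U, (g u).IsSymm) ∧ (∀ u ∈ U, IsUnit (g u).det)

/-- Christoffel symbols `Γ^i_{jk}` of the Levi-Civita connection of the contravariant metric `g`,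
where the covariant metric `g_{ij}` is the matrix inverse of `g`. -/
noncomputable def christoffel {N : ℕ} (g : MetF N) (i j k : Fin N) (u : Fin N → ℝ) : ℝ :=
  (1 / 2) * ∑ s, g u i s *
    (pd (fun v => (g v)⁻¹ s k) j u + pd (fun v => (g v)⁻¹ j s) k u -
      pd (fun v => (g v)⁻¹ j k) s u)

/-- Raised Christoffel symbols `Γ^{ij}_k = Σ_s g^{is} Γ^j_{sk}`. -/
noncomputable def christoffelR {N : ℕ} (g : MetF N) (i j k : Fin N) (u : Fin N → ℝ) : ℝ :=
  ∑ s, g u i s * christoffel g j s k u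

/-- Riemannian curvature tensor `R^i_{jkl}` of the contravariant metric `g`. -/
noncomputable def curvature {N : ℕ} (g : MetF N) (i j k l : Fin N) (u : Fin N → ℝ) : ℝ :=
  pd (christoffel g i j l) k u - pd (christoffel g i j k) l u +
    ∑ p, (christoffel g i p k u * christoffel g p j l u -
          christoffel g i p l u * christoffel g p j k u)

/-- Raised curvature tensor `R^{ij}_{kl} = Σ_s g^{is} R^j_{skl}`. -/
noncomputable def curvatureR {N : ℕ} (g : MetF N) (i j k l : Fin N) (u : Fin N → ℝ) : ℝ :=
  ∑ s, g u i s * curvature g j s k l u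

/-- Two metrics are almost compatible on `U` if the raised Christoffel symbols of every
(invertible) linear combination are the corresponding linear combination. -/
def AlmostCompatibleOn {N : ℕ} (g1 g2 : MetF N) (U : Set (Fin N → ℝ)) : Prop :=
  ∀ l1 l2 : ℝ, ∀ u ∈ U, IsUnit (l1 • g1 u + l2 • g2 u).det →
    ∀ i j k, christoffelR (fun v => l1 • g1 v + l2 • g2 v) i j k u =
      l1 * christoffelR g1 i j k u + l2 * christoffelR g2 i j k u

/-- Two metrics are compatible on `U` if additionally the raised curvature tensors of every
(invertible) linear combination are the corresponding linear combination. -/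
def CompatibleOn {N : ℕ} (g1 g2 : MetF N) (U : Set (Fin N → ℝ)) : Prop :=
  AlmostCompatibleOn g1 g2 U ∧
  ∀ l1 l2 : ℝ, ∀ u ∈ U, IsUnit (l1 • g1 u + l2 • g2 u).det →
    ∀ i j k l, curvatureR (fun v => l1 • g1 v + l2 • g2 v) i j k l u =
      l1 * curvatureR g1 i j k l u + l2 * curvatureR g2 i j k l u

/-- The Nijenhuis tensor `N^k_{ij}` of an affinor `v^i_j(u)`. -/
noncomputable def nijenhuisT {N : ℕ} (v : MetF N) (k i j : Fin N) (u : Fin N → ℝ) : ℝ :=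
  ∑ s, (v u s i * pd (fun w => v w k j) s u - v u s j * pd (fun w => v w k i) s u +
        v u k s * pd (fun w => v w s i) j u - v u k s * pd (fun w => v w s j) i u)

/-- A pair of metrics is non-singular on `U` if at every point the affinor `v = g1 · g2⁻¹` has `N`
pairwise distinct real eigenvalues (its characteristic polynomial splits with distinct real
roots). -/
def NonSingularPairOn {N : ℕ} (g1 g2 : MetF N) (U : Set (Fin N → ℝ)) : Prop :=
  ∀ u ∈ U, ∃ f : Fin N → ℝ, Function.Injective f ∧
    (g1 u * (g2 u)⁻¹).charpoly = ∏ i, (Polynomial.X - Polynomial.C (f i))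

/-! ### Linear algebra -/

/-- An adapted frame of the pair at a point. -/
structure Frame {N : ℕ} (a1 a2 : Matrix (Fin N) (Fin N) ℝ) where
  P : Matrix (Fin N) (Fin N) ℝ
  Q : Matrix (Fin N) (Fin N) ℝ
  f : Fin N → ℝ
  e : Fin N → ℝ
  hPQ : P * Q = 1
  hQP : Q * P = 1
  hf : Function.Injective f
  hf0 : ∀ i, f i ≠ 0
  he0 : ∀ i, e i ≠ 0
  h2 : a2 = P * diagonal e * Pᵀ
  h1 : a1 = P * diagonal (fun i => f i * e i) * Pᵀ

lemma diag_of_commute {N : ℕ} (f : Fin N → ℝ) (hf : Function.Injective f)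
    (h : Matrix (Fin N) (Fin N) ℝ) (hc : diagonal f * h = h * diagonal f) :
    h = diagonal (fun i => h i i) := by
  ext a b
  by_cases hab : a = b
  · subst hab; simp
  · rw [diagonal_apply_ne _ hab]
    have := congrFun (congrFun hc a) b
    rw [diagonal_mul, mul_diagonal] at this
    have h3 : (f a - f b) * h a b = 0 := by linarith
    rcases mul_eq_zero.1 h3 with h4 | h4
    · exact absurd (hf (sub_eq_zero.1 h4)) hab
    · exact h4

lemma exists_frame {N : ℕ} (a1 a2 : Matrix (Fin N) (Fin N) ℝ)
    (s1 : a1.IsSymm) (s2 : a2.IsSymm) (u1 : IsUnit a1.det) (u2 : IsUnit a2.det)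
    (f : Fin N → ℝ) (hf : Function.Injective f)
    (hc : (a1 * a2⁻¹).charpoly = ∏ i, (Polynomial.X - Polynomial.C (f i))) :
    Nonempty (Frame a1 a2) := by
  set v := a1 * a2⁻¹ with hv
  have hev : ∀ i, ∃ x : Fin N → ℝ, x ≠ 0 ∧ v *ᵥ x = f i • x := by
    intro i
    have h0 : (v.charpoly).eval (f i) = 0 := by
      rw [hc, Polynomial.eval_prod]
      exact Finset.prod_eq_zero (Finset.mem_univ i) (by simp)
    rw [Matrix.eval_charpoly] at h0
    obtain ⟨x, hx, hx2⟩ := Matrix.exists_mulVec_eq_zero_iff.2 h0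
    refine ⟨x, hx, ?_⟩
    rw [Matrix.sub_mulVec, sub_eq_zero] at hx2
    rw [← hx2]
    simp
  choose x hx hvx using hev
  have hli : LinearIndependent ℝ x := by
    refine Module.End.eigenvectors_linearIndependent' (Matrix.toLin' v) f hf x ?_
    intro i
    refine ⟨?_, hx i⟩
    rw [Module.End.mem_eigenspace_iff]
    simpa using hvx i
  set P : Matrix (Fin N) (Fin N) ℝ := Matrix.of (fun a i => x i a) with hP
  have hPu : IsUnit P := by
    rw [← Matrix.linearIndependent_cols_iff_isUnit]
    exact hli
  have hPd : IsUnit P.det := (Matrix.isUnit_iff_isUnit_det _).1 hPu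
  have hPQ : P * P⁻¹ = 1 := Matrix.mul_nonsing_inv _ hPd
  have hQP : P⁻¹ * P = 1 := Matrix.nonsing_inv_mul _ hPd
  have hvP : v * P = P * diagonal f := by
    ext a i
    rw [mul_diagonal]
    have := congrFun (hvx i) a
    simp only [Pi.smul_apply, smul_eq_mul] at this
    rw [hP, Matrix.of_apply, mul_comm, ← this]
    rfl
  set Q := P⁻¹ with hQ
  have hQv : Q * v = diagonal f * Q := by
    calc Q * v = Q * (v * P) * Q := by
          rw [Matrix.mul_assoc, Matrix.mul_assoc, hPQ, Matrix.mul_one]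
      _ = (Q * P) * diagonal f * Q := by rw [hvP]; simp only [Matrix.mul_assoc]
      _ = _ := by rw [hQP, Matrix.one_mul]
  have hva : v * a2 = a1 := by
    rw [hv, Matrix.mul_assoc, Matrix.nonsing_inv_mul _ u2, Matrix.mul_one]
  have hva' : a2 * vᵀ = a1 := by
    have := congrArg Matrix.transpose hva
    rw [Matrix.transpose_mul, s1.eq, s2.eq] at this
    exact this
  have hvQ : vᵀ * Qᵀ = Qᵀ * diagonal f := by
    rw [← Matrix.transpose_mul, hQv, Matrix.transpose_mul, diagonal_transpose]
  set h := Q * a2 * Qᵀ with hh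
  have hcom : diagonal f * h = h * diagonal f := by
    calc diagonal f * h = (diagonal f * Q) * a2 * Qᵀ := by rw [hh]; simp only [Matrix.mul_assoc]
      _ = Q * (v * a2) * Qᵀ := by rw [← hQv]; simp only [Matrix.mul_assoc]
      _ = Q * (a2 * vᵀ) * Qᵀ := by rw [hva, hva']
      _ = Q * a2 * (vᵀ * Qᵀ) := by simp only [Matrix.mul_assoc]
      _ = _ := by rw [hvQ, hh]; simp only [Matrix.mul_assoc]
  have hd := diag_of_commute f hf h hcom
  set e : Fin N → ℝ := fun i => h i i with he
  have hQPt : Qᵀ * Pᵀ = 1 := by rw [← Matrix.transpose_mul, hPQ, Matrix.transpose_one]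
  have e2 : a2 = P * diagonal e * Pᵀ := by
    rw [← hd, hh]
    calc a2 = (P * Q) * a2 * (Qᵀ * Pᵀ) := by rw [hPQ, hQPt]; simp
      _ = _ := by simp only [Matrix.mul_assoc]
  have e1 : a1 = P * diagonal (fun i => f i * e i) * Pᵀ := by
    rw [← hva, e2, ← diagonal_mul_diagonal]
    calc v * (P * diagonal e * Pᵀ) = (v * P) * diagonal e * Pᵀ := by simp only [Matrix.mul_assoc]
      _ = _ := by rw [hvP]; simp only [Matrix.mul_assoc]
  have n1 : ∀ i, f i * e i ≠ 0 := by
    have : a1.det ≠ 0 := u1.ne_zero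
    rw [e1, Matrix.det_mul, Matrix.det_mul, det_diagonal] at this
    have h3 := right_ne_zero_of_mul (left_ne_zero_of_mul this)
    intro i
    exact Finset.prod_ne_zero_iff.1 h3 i (Finset.mem_univ i)
  exact ⟨⟨P, Q, f, e, hPQ, hQP, hf, fun i => left_ne_zero_of_mul (n1 i),
    fun i => right_ne_zero_of_mul (n1 i), e2, e1⟩⟩

lemma scalar_key {N : ℕ} (f e : Fin N → ℝ) (hf : Function.Injective f) (hf0 : ∀ i, f i ≠ 0)
    (he0 : ∀ i, e i ≠ 0) (d : Fin N → Fin N → Fin N → ℝ) (hd : ∀ k c j, d k c j = d k j c)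
    (w : Fin N → Fin N → Fin N → ℝ)
    (hw : ∀ k c j, w k c j = d k c j * f j + f k * e k * d j c k * (e j)⁻¹)
    (hn : ∀ k c j, (f c - f k) * w k c j = (f j - f k) * w k j c) :
    ∀ k c j, c ≠ j → d k c j = 0 := by
  have hne : ∀ i j, i ≠ j → f i - f j ≠ 0 := fun i j hij h => hij (hf (sub_eq_zero.1 h))
  have A : ∀ c j, c ≠ j → d c c j = 0 := by
    intro c j hcj
    have h1 := hn c c j
    rw [sub_self, zero_mul] at h1
    have h2 : w c j c = 0 := by
      rcases mul_eq_zero.1 h1.symm with h | h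
      · exact absurd h (hne j c hcj.symm)
      · exact h
    rw [hw] at h2
    have h3 : f c * e c * d c j c * (e c)⁻¹ = f c * d c j c := by
      field_simp [he0 c]
    rw [h3] at h2
    have h4 : f c * d c j c = 0 := by linarith
    rw [hd]
    exact (mul_eq_zero.1 h4).resolve_left (hf0 c)
  intro k c j hcj
  by_cases hkc : k = c
  · subst hkc; exact A k j hcj
  by_cases hkj : k = j
  · subst hkj; rw [hd]; exact A k c (Ne.symm hcj)
  -- normalised symmetric quantities
  have W : ∀ k c j, w k c j * (e k)⁻¹ = d k c j * (e k)⁻¹ * f j + f k * (d j c k * (e j)⁻¹) := by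
    intro k c j
    rw [hw]
    field_simp [he0 k, he0 j]
  set s : Fin N → Fin N → Fin N → ℝ := fun k c j => d k c j * (e k)⁻¹ with hs
  have ss : ∀ k c j, s k c j = s k j c := fun k c j => by simp only [hs]; rw [hd]
  have M : ∀ k c j, (f c - f k) * (s k c j * f j + f k * s j c k) =
      (f j - f k) * (s k j c * f c + f k * s c j k) := by
    intro k c j
    have h1 := congrArg (· * (e k)⁻¹) (hn k c j)
    simp only [mul_assoc] at h1
    rw [W, W] at h1
    exact h1
  have m1 := M k c j
  have m2 := M c k j
  have m3 := M j c k
  rw [ss c j k, ss k j c, ss j c k] at *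
  have a1 := hne k c hkc
  have a2 := hne k j hkj
  have a3 := hne c j hcj
  have hwc : s k c j * f j + f k * s j k c = 0 := by
    have h2 : (f k - f c) * (f c - f j) * (s k c j * f j + f k * s j k c) = 0 := by
      linear_combination (1 / 2 : ℝ) * (f k - f j) * m2 + (1 / 2 : ℝ) * (f k - f c) * m3
        + (1 / 2 : ℝ) * (f j - f c) * m1
    exact (mul_eq_zero.1 h2).resolve_left (mul_ne_zero a1 a3)
  have hwj : s k c j * f c + f k * s c k j = 0 := by
    rw [hwc, mul_zero] at m1
    exact (mul_eq_zero.1 m1.symm).resolve_left (sub_ne_zero.2 (sub_ne_zero.1 a2).symm)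
  have hwk : s c k j * f j + f c * s j k c = 0 := by
    have h2 : (f k - f c) * (s c k j * f j + f c * s j k c) = 0 := by
      rw [m2]; linear_combination (f j - f c) * hwj
    exact (mul_eq_zero.1 h2).resolve_left a1
  have h5 : (f j * f c) * s k c j = 0 := by
    linear_combination (1 / 2 : ℝ) * (f c * hwc + f j * hwj - f k * hwk)
  have h6 := (mul_eq_zero.1 h5).resolve_left (mul_ne_zero (hf0 j) (hf0 c))
  simp only [hs] at h6
  exact (mul_eq_zero.1 h6).resolve_right (inv_ne_zero (he0 k))

/-! ### Calculus of matrix fields -/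

noncomputable def pdM {N : ℕ} (A : MetF N) (k : Fin N) (u : Fin N → ℝ) :
    Matrix (Fin N) (Fin N) ℝ := Matrix.of fun i j => pd (fun w => A w i j) k u

/-- `(Γ^j)_{sk}` -/
noncomputable def GU {N : ℕ} (g : MetF N) (j : Fin N) (u : Fin N → ℝ) :
    Matrix (Fin N) (Fin N) ℝ := Matrix.of fun s k => christoffel g j s k u

/-- `(Γ_k)^i_s` -/
noncomputable def GLo {N : ℕ} (g : MetF N) (k : Fin N) (u : Fin N → ℝ) :
    Matrix (Fin N) (Fin N) ℝ := Matrix.of fun i s => christoffel g i s k u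

def DiffM {N : ℕ} (A : MetF N) (u : Fin N → ℝ) : Prop :=
  ∀ i j, DifferentiableAt ℝ (fun w => A w i j) u

lemma pd_congr {N : ℕ} {f g : (Fin N → ℝ) → ℝ} {u : Fin N → ℝ} (k : Fin N)
    (h : f =ᶠ[nhds u] g) : pd f k u = pd g k u := by
  unfold pd; rw [h.fderiv_eq]

lemma pd_add {N : ℕ} {f g : (Fin N → ℝ) → ℝ} {u : Fin N → ℝ} (k : Fin N)
    (hf : DifferentiableAt ℝ f u) (hg : DifferentiableAt ℝ g u) :
    pd (fun w => f w + g w) k u = pd f k u + pd g k u := by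
  unfold pd; rw [fderiv_fun_add hf hg]; rfl

lemma pd_const_mul {N : ℕ} {f : (Fin N → ℝ) → ℝ} {u : Fin N → ℝ} (k : Fin N) (c : ℝ)
    (hf : DifferentiableAt ℝ f u) :
    pd (fun w => c * f w) k u = c * pd f k u := by
  unfold pd; rw [fderiv_const_mul hf]; rfl

lemma pd_mul {N : ℕ} {f g : (Fin N → ℝ) → ℝ} {u : Fin N → ℝ} (k : Fin N)
    (hf : DifferentiableAt ℝ f u) (hg : DifferentiableAt ℝ g u) :
    pd (fun w => f w * g w) k u = pd f k u * g u + f u * pd g k u := by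
  unfold pd; rw [fderiv_fun_mul hf hg]
  simp only [_root_.add_apply, _root_.smul_apply, smul_eq_mul]
  ring

lemma pd_sum {N : ℕ} {ι : Type*} (s : Finset ι) {f : ι → (Fin N → ℝ) → ℝ} {u : Fin N → ℝ}
    (k : Fin N) (hf : ∀ i ∈ s, DifferentiableAt ℝ (f i) u) :
    pd (fun w => ∑ i ∈ s, f i w) k u = ∑ i ∈ s, pd (f i) k u := by
  unfold pd; rw [fderiv_fun_sum hf]; simp

lemma pdM_mul {N : ℕ} {A B : MetF N} {u : Fin N → ℝ} (k : Fin N) (hA : DiffM A u)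
    (hB : DiffM B u) : pdM (fun w => A w * B w) k u = pdM A k u * B u + A u * pdM B k u := by
  ext i j
  simp only [pdM, Matrix.of_apply, Matrix.add_apply, Matrix.mul_apply]
  rw [pd_sum _ _ (fun s _ => (hA i s).fun_mul (hB s j)), ← Finset.sum_add_distrib]
  exact Finset.sum_congr rfl fun s _ => pd_mul k (hA i s) (hB s j)

lemma inv_contDiffOn {N : ℕ} {g : MetF N} {V : Set (Fin N → ℝ)} (hg : IsMetricOn g V)
    (i j : Fin N) : ContDiffOn ℝ (⊤ : ℕ∞) (fun u => (g u)⁻¹ i j) V := by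
  have hdet : ∀ A : MetF N, (∀ i j, ContDiffOn ℝ (⊤ : ℕ∞) (fun u => A u i j) V) →
      ContDiffOn ℝ (⊤ : ℕ∞) (fun u => (A u).det) V := by
    intro A hA
    simp only [Matrix.det_apply']
    exact ContDiffOn.sum fun σ _ => contDiffOn_const.mul (contDiffOn_prod fun i _ => hA _ _)
  have hadj : ContDiffOn ℝ (⊤ : ℕ∞) (fun u => (g u).adjugate i j) V := by
    simp only [Matrix.adjugate_apply]
    refine hdet (fun u => (g u).updateRow j (Pi.single i 1)) ?_
    intro a b
    by_cases h : a = j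
    · subst h; simp only [Matrix.updateRow_self]; exact contDiffOn_const
    · simp only [Matrix.updateRow_ne h]; exact hg.1 a b
  have := (ContDiffOn.inv (hdet g hg.1) (fun u hu => (hg.2.2 u hu).ne_zero)).mul hadj
  refine this.congr ?_
  intro u hu
  simp [Matrix.inv_def, Ring.inverse_eq_inv']

lemma pd_diff {N : ℕ} {f : (Fin N → ℝ) → ℝ} {V : Set (Fin N → ℝ)} (hV : IsOpen V)
    (hf : ContDiffOn ℝ (⊤ : ℕ∞) f V) (k : Fin N) {u : Fin N → ℝ} (hu : u ∈ V) :
    DifferentiableAt ℝ (pd f k) u := by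
  have h1 : ContDiffAt ℝ (⊤ : ℕ∞) f u := hf.contDiffAt (hV.mem_nhds hu)
  have h2 : ContDiffAt ℝ 1 (fderiv ℝ f) u := h1.fderiv_right (m := 1) (by decide)
  exact (h2.differentiableAt (by norm_num)).clm_apply (differentiableAt_const _)

section metric
variable {N : ℕ} {g : MetF N} {V : Set (Fin N → ℝ)} {u : Fin N → ℝ}

lemma metric_diff (hV : IsOpen V) (hg : IsMetricOn g V) (hu : u ∈ V) : DiffM g u := fun i j =>
  ((hg.1 i j).contDiffAt (hV.mem_nhds hu)).differentiableAt (by simp)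

lemma inv_diff (hV : IsOpen V) (hg : IsMetricOn g V) (hu : u ∈ V) :
    DiffM (fun w => (g w)⁻¹) u := fun i j =>
  ((inv_contDiffOn hg i j).contDiffAt (hV.mem_nhds hu)).differentiableAt (by simp)

lemma christoffel_diff (hV : IsOpen V) (hg : IsMetricOn g V) (hu : u ∈ V) (i j k : Fin N) :
    DifferentiableAt ℝ (christoffel g i j k) u := by
  unfold christoffel
  refine DifferentiableAt.const_mul (DifferentiableAt.fun_sum fun s _ => ?_) _
  refine (metric_diff hV hg hu i s).mul ?_
  exact ((pd_diff hV (inv_contDiffOn hg s k) j hu).add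
    (pd_diff hV (inv_contDiffOn hg j s) k hu)).sub (pd_diff hV (inv_contDiffOn hg j k) s hu)

lemma inv_symm_ev (hV : IsOpen V) (hg : IsMetricOn g V) (hu : u ∈ V) (i j : Fin N) :
    (fun w => (g w)⁻¹ i j) =ᶠ[nhds u] (fun w => (g w)⁻¹ j i) := by
  filter_upwards [hV.mem_nhds hu] with w hw
  have : ((g w)⁻¹)ᵀ = (g w)⁻¹ := by rw [Matrix.transpose_nonsing_inv, (hg.2.1 w hw).eq]
  exact (congrFun (congrFun this j) i)

lemma christoffel_symm (hV : IsOpen V) (hg : IsMetricOn g V) (hu : u ∈ V) (i j k : Fin N) :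
    christoffel g i j k u = christoffel g i k j u := by
  unfold christoffel
  congr 1
  refine Finset.sum_congr rfl fun s _ => ?_
  rw [pd_congr j (inv_symm_ev hV hg hu s k), pd_congr k (inv_symm_ev hV hg hu j s),
    pd_congr s (inv_symm_ev hV hg hu j k)]
  ring

lemma GU_symm (hV : IsOpen V) (hg : IsMetricOn g V) (hu : u ∈ V) (j : Fin N) :
    (GU g j u)ᵀ = GU g j u := by
  ext a b
  exact christoffel_symm hV hg hu j b a

lemma pdM_inv (hV : IsOpen V) (hg : IsMetricOn g V) (hu : u ∈ V) (k : Fin N) :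
    pdM g k u = - (g u * pdM (fun w => (g w)⁻¹) k u * g u) := by
  have h1 := pdM_mul k (metric_diff hV hg hu) (inv_diff hV hg hu)
  have h2 : pdM (fun w => g w * (g w)⁻¹) k u = 0 := by
    ext i j
    simp only [pdM, Matrix.of_apply, Matrix.zero_apply]
    have : (fun w => (g w * (g w)⁻¹) i j) =ᶠ[nhds u] fun _ => (1 : Matrix _ _ ℝ) i j := by
      filter_upwards [hV.mem_nhds hu] with w hw
      rw [Matrix.mul_nonsing_inv _ (hg.2.2 w hw)]
    rw [pd_congr k this]
    simp [pd]
  rw [h2] at h1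
  have h3 : pdM g k u * (g u)⁻¹ * g u = pdM g k u := by
    rw [Matrix.mul_assoc, Matrix.nonsing_inv_mul _ (hg.2.2 u hu), Matrix.mul_one]
  have h4 := congrArg (· * g u) h1
  simp only [Matrix.zero_mul, Matrix.add_mul] at h4
  rw [h3] at h4
  exact eq_neg_of_add_eq_zero_left h4.symm

lemma metric_compat (hV : IsOpen V) (hg : IsMetricOn g V) (hu : u ∈ V) (k : Fin N) :
    pdM g k u = - (GLo g k u * g u + g u * (GLo g k u)ᵀ) := by
  rw [pdM_inv hV hg hu]
  congr 1
  have hs := hg.2.1 u hu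
  set E : Matrix (Fin N) (Fin N) ℝ := Matrix.of fun t s =>
    pd (fun v => (g v)⁻¹ t k) s u - pd (fun v => (g v)⁻¹ s k) t u with hE
  set H := pdM (fun w => (g w)⁻¹) k u with hH
  have hHs : Hᵀ = H := by
    ext a b
    exact pd_congr k (inv_symm_ev hV hg hu b a)
  have hEs : Eᵀ = - E := by
    ext a b
    simp [hE]
  have hGL : GLo g k u = (1 / 2 : ℝ) • (g u * (H + E)) := by
    ext i s
    simp only [GLo, christoffel, Matrix.of_apply, Matrix.smul_apply, smul_eq_mul, Matrix.mul_apply]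
    congr 1
    refine Finset.sum_congr rfl fun t _ => ?_
    rw [pd_congr k (inv_symm_ev hV hg hu s t)]
    simp only [hH, hE, pdM, Matrix.add_apply, Matrix.of_apply]
    ring
  rw [hGL, Matrix.transpose_smul, Matrix.transpose_mul, Matrix.transpose_add, hHs, hEs, hs.eq]
  simp only [Matrix.mul_add, Matrix.add_mul, smul_add, Matrix.smul_mul, Matrix.mul_smul,
    Matrix.neg_mul, Matrix.mul_neg, smul_neg, Matrix.mul_assoc]
  module

lemma metric_compat' (hV : IsOpen V) (hg : IsMetricOn g V) (hu : u ∈ V) (k i j : Fin N) :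
    pd (fun w => g w i j) k u = - ((g u * GU g j u) i k + (g u * GU g i u) j k) := by
  have hs := (hg.2.1 u hu).eq
  have := congrFun (congrFun (metric_compat hV hg hu k) i) j
  simp only [pdM, Matrix.of_apply] at this
  rw [this, Matrix.neg_apply, Matrix.add_apply, add_comm]
  congr 2
  rw [Matrix.mul_apply, Matrix.mul_apply]
  refine Finset.sum_congr rfl fun t _ => ?_
  rw [mul_comm, ← congrFun (congrFun hs t) j]
  rfl

/-- Uniqueness of the Levi-Civita connection. -/
lemma lc_unique (hV : IsOpen V) (hg : IsMetricOn g V) (hu : u ∈ V)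
    (C : Fin N → Matrix (Fin N) (Fin N) ℝ) (hC : ∀ j, (C j)ᵀ = C j)
    (hm : ∀ k i j, pd (fun w => g w i j) k u = - ((g u * C j) i k + (g u * C i) j k)) (j : Fin N) :
    GU g j u = C j := by
  set T : Fin N → Matrix (Fin N) (Fin N) ℝ := fun j => GU g j u - C j with hT
  have hs := (hg.2.1 u hu).eq
  have hTs : ∀ j, (T j)ᵀ = T j := fun j => by
    simp only [hT, Matrix.transpose_sub, hC, GU_symm hV hg hu]
  have hG := fun k i j => metric_compat' hV hg hu k i j
  have hA : ∀ k i j, (g u * T j) i k = - (g u * T i) j k := by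
    intro k i j
    have h1 := hG k i j
    rw [hm k i j] at h1
    simp only [hT, Matrix.mul_sub, Matrix.sub_apply]
    linarith
  set X : Fin N → Fin N → Fin N → ℝ := fun i j l => (g u * T j * g u) i l with hX
  have x1 : ∀ i j l, X i j l = X l j i := by
    intro i j l
    have : (g u * T j * g u)ᵀ = g u * T j * g u := by
      rw [Matrix.transpose_mul, Matrix.transpose_mul, hTs, hs, Matrix.mul_assoc]
    exact congrFun (congrFun this l) i
  have x2 : ∀ i j l, X i j l = - X j i l := by
    intro i j l
    simp only [hX]
    rw [Matrix.mul_apply, Matrix.mul_apply, ← Finset.sum_neg_distrib]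
    refine Finset.sum_congr rfl fun t _ => ?_
    rw [hA]; ring
  have x0 : ∀ i j l, X i j l = 0 := by
    intro i j l
    have a := x2 i j l
    have b := x1 j i l
    have c := x2 l i j
    have d := x1 i l j
    have e := x2 j l i
    have f := x1 l j i
    linarith
  have hz : g u * T j * g u = 0 := by
    ext i l; exact x0 i j l
  have hu' := hg.2.2 u hu
  have : T j = 0 := by
    calc T j = (g u)⁻¹ * (g u * T j * g u) * (g u)⁻¹ := by
          simp only [Matrix.mul_assoc]
          rw [Matrix.mul_nonsing_inv _ hu', Matrix.mul_one, ← Matrix.mul_assoc,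
            Matrix.nonsing_inv_mul _ hu', Matrix.one_mul]
      _ = 0 := by rw [hz]; simp
  exact sub_eq_zero.1 this

lemma christoffelR_eq (i j k : Fin N) : christoffelR g i j k u = (g u * GU g j u) i k := by
  simp [christoffelR, GU, Matrix.mul_apply]

lemma curvatureR_eq (hV : IsOpen V) (hg : IsMetricOn g V) (hu : u ∈ V) (i j k l : Fin N) :
    curvatureR g i j k l u =
      pd (christoffelR g i j l) k u - pd (christoffelR g i j k) l u +
        ((GU g i u * g u * GU g j u) k l - (GU g i u * g u * GU g j u) l k) := by
  have hR : ∀ k l, pd (christoffelR g i j l) k u =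
      ∑ s, (pd (fun w => g w i s) k u * christoffel g j s l u +
        g u i s * pd (christoffel g j s l) k u) := by
    intro k l
    have : christoffelR g i j l = fun u => ∑ s, g u i s * christoffel g j s l u := rfl
    rw [this, pd_sum _ _ (fun s _ => (metric_diff hV hg hu i s).fun_mul
      (christoffel_diff hV hg hu j s l))]
    exact Finset.sum_congr rfl fun s _ => pd_mul k (metric_diff hV hg hu i s)
      (christoffel_diff hV hg hu j s l)
  have hS : ∀ k l, ∑ s, pd (fun w => g w i s) k u * christoffel g j s l u =
      - (∑ s, g u i s * ∑ p, christoffel g j p l u * christoffel g p s k u)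
      - (GU g i u * g u * GU g j u) k l := by
    intro k l
    have e1 : (GU g i u * g u * GU g j u) k l =
        ∑ s, (g u * GU g i u) s k * christoffel g j s l u := by
      rw [Matrix.mul_apply]
      refine Finset.sum_congr rfl fun s _ => ?_
      congr 1
      have : (g u * GU g i u)ᵀ = GU g i u * g u := by
        rw [Matrix.transpose_mul, GU_symm hV hg hu, (hg.2.1 u hu).eq]
      rw [← this]; rfl
    have e2 : ∑ s, g u i s * ∑ p, christoffel g j p l u * christoffel g p s k u =
        ∑ s, (g u * GU g s u) i k * christoffel g j s l u := by
      simp only [Finset.mul_sum, Matrix.mul_apply, Finset.sum_mul]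
      rw [Finset.sum_comm]
      refine Finset.sum_congr rfl fun s _ => Finset.sum_congr rfl fun t _ => ?_
      simp only [GU, Matrix.of_apply]; ring
    rw [e1, e2, ← Finset.sum_neg_distrib, ← Finset.sum_sub_distrib]
    refine Finset.sum_congr rfl fun s _ => ?_
    rw [metric_compat' hV hg hu]; ring
  rw [hR, hR, Finset.sum_add_distrib, Finset.sum_add_distrib, hS, hS]
  have : curvatureR g i j k l u = ∑ s, g u i s * pd (christoffel g j s l) k u
      - ∑ s, g u i s * pd (christoffel g j s k) l u
      + ((∑ s, g u i s * ∑ p, christoffel g j p k u * christoffel g p s l u)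
      - ∑ s, g u i s * ∑ p, christoffel g j p l u * christoffel g p s k u) := by
    rw [← Finset.sum_sub_distrib, ← Finset.sum_sub_distrib, ← Finset.sum_add_distrib]
    unfold curvatureR curvature
    refine Finset.sum_congr rfl fun s _ => ?_
    rw [Finset.sum_sub_distrib]
    ring
  rw [this]
  ring

end metric

/-! ### Pairs of metrics -/

section pair
variable {N : ℕ} {g1 g2 : MetF N} {U : Set (Fin N → ℝ)} {u : Fin N → ℝ}

/-- the difference tensor of the two connections is diagonal in the frame -/
def IsDiagAt (g1 g2 : MetF N) (u : Fin N → ℝ) : Prop :=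
  ∃ F : Frame (g1 u) (g2 u), ∃ d : Fin N → Fin N → ℝ,
    ∀ j, GU g2 j u - GU g1 j u = F.Qᵀ * diagonal (d j) * F.Q

lemma comb_open (hU : IsOpen U) (hg1 : IsMetricOn g1 U) (hg2 : IsMetricOn g2 U) (l1 l2 : ℝ) :
    IsOpen (U ∩ {w | IsUnit (l1 • g1 w + l2 • g2 w).det}) := by
  have hc : ContinuousOn (fun w => (l1 • g1 w + l2 • g2 w).det) U := by
    simp only [Matrix.det_apply']
    refine continuousOn_finsetSum _ fun σ _ => continuousOn_const.mul
      (continuousOn_finsetProd _ fun i _ => ?_)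
    exact (continuousOn_const.mul (hg1.1 _ _).continuousOn).add
      (continuousOn_const.mul (hg2.1 _ _).continuousOn)
  have := hc.isOpen_inter_preimage hU (isOpen_compl_singleton (x := (0 : ℝ)))
  convert this using 2
  ext w
  simp [isUnit_iff_ne_zero]

lemma comb_metric (hg1 : IsMetricOn g1 U) (hg2 : IsMetricOn g2 U) (l1 l2 : ℝ) :
    IsMetricOn (fun w => l1 • g1 w + l2 • g2 w)
      (U ∩ {w | IsUnit (l1 • g1 w + l2 • g2 w).det}) := by
  refine ⟨fun i j => ?_, fun w hw => ?_, fun w hw => hw.2⟩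
  · exact ((contDiffOn_const.mul (hg1.1 i j)).add (contDiffOn_const.mul (hg2.1 i j))).mono
      Set.inter_subset_left
  · have h1 := (hg1.2.1 w hw.1).eq
    have h2 := (hg2.2.1 w hw.1).eq
    change (l1 • g1 w + l2 • g2 w)ᵀ = _
    rw [Matrix.transpose_add, Matrix.transpose_smul, Matrix.transpose_smul, h1, h2]

lemma Frame.comb {a1 a2 : Matrix (Fin N) (Fin N) ℝ} (F : Frame a1 a2) (l1 l2 : ℝ) :
    l1 • a1 + l2 • a2 = F.P * diagonal (fun i => (l1 * F.f i + l2) * F.e i) * F.Pᵀ := by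
  have : diagonal (fun i => (l1 * F.f i + l2) * F.e i) =
      l1 • diagonal (fun i => F.f i * F.e i) + l2 • diagonal F.e := by
    rw [← diagonal_smul, ← diagonal_smul, diagonal_add]
    congr 1
    ext i
    simp only [Pi.smul_apply, smul_eq_mul]; ring
  rw [this]
  refine (congrArg₂ (fun x y => l1 • x + l2 • y) F.h1 F.h2).trans ?_
  simp only [Matrix.mul_add, Matrix.add_mul, Matrix.mul_smul, Matrix.smul_mul]

lemma Frame.hPQt {a1 a2 : Matrix (Fin N) (Fin N) ℝ} (F : Frame a1 a2) : F.Pᵀ * F.Qᵀ = 1 := by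
  rw [← Matrix.transpose_mul, F.hQP, Matrix.transpose_one]

lemma Frame.hQPt {a1 a2 : Matrix (Fin N) (Fin N) ℝ} (F : Frame a1 a2) : F.Qᵀ * F.Pᵀ = 1 := by
  rw [← Matrix.transpose_mul, F.hPQ, Matrix.transpose_one]

lemma Frame.up_down {a1 a2 : Matrix (Fin N) (Fin N) ℝ} (F : Frame a1 a2) (m y : Fin N → ℝ) :
    (F.P * diagonal m * F.Pᵀ) * (F.Qᵀ * diagonal y * F.Q) =
      F.P * diagonal (fun i => m i * y i) * F.Q := by
  rw [← diagonal_mul_diagonal]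
  calc _ = F.P * diagonal m * (F.Pᵀ * F.Qᵀ) * (diagonal y * F.Q) := by
        simp only [Matrix.mul_assoc]
    _ = _ := by rw [F.hPQt]; simp only [Matrix.mul_assoc, Matrix.mul_one]

lemma Frame.g2_down {a1 a2 : Matrix (Fin N) (Fin N) ℝ} (F : Frame a1 a2) (y : Fin N → ℝ) :
    a2 * (F.Qᵀ * diagonal y * F.Q) = F.P * diagonal (fun i => F.e i * y i) * F.Q :=
  (congrArg (fun M => M * (F.Qᵀ * diagonal y * F.Q)) F.h2).trans (F.up_down F.e y)

lemma Frame.down_mix {a1 a2 : Matrix (Fin N) (Fin N) ℝ} (F : Frame a1 a2) (y m : Fin N → ℝ) :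
    (F.Qᵀ * diagonal y * F.Q) * (F.P * diagonal m * F.Q) =
      F.Qᵀ * diagonal (fun i => y i * m i) * F.Q := by
  rw [← diagonal_mul_diagonal]
  calc _ = F.Qᵀ * diagonal y * (F.Q * F.P) * (diagonal m * F.Q) := by
        simp only [Matrix.mul_assoc]
    _ = _ := by rw [F.hQP]; simp only [Matrix.mul_assoc, Matrix.mul_one]

lemma Frame.down_symm {a1 a2 : Matrix (Fin N) (Fin N) ℝ} (F : Frame a1 a2) (y : Fin N → ℝ) :
    (F.Qᵀ * diagonal y * F.Q)ᵀ = F.Qᵀ * diagonal y * F.Q := by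
  simp [Matrix.transpose_mul, Matrix.mul_assoc]

lemma Frame.comb_ne {a1 a2 : Matrix (Fin N) (Fin N) ℝ} (F : Frame a1 a2) (l1 l2 : ℝ)
    (hd : IsUnit (l1 • a1 + l2 • a2).det) (i : Fin N) : l1 * F.f i + l2 ≠ 0 := by
  have h := hd.ne_zero
  rw [F.comb, Matrix.det_mul, Matrix.det_mul, det_diagonal] at h
  exact left_ne_zero_of_mul (Finset.prod_ne_zero_iff.1
    (right_ne_zero_of_mul (left_ne_zero_of_mul h)) i (Finset.mem_univ i))

lemma Frame.comb_unit {a1 a2 : Matrix (Fin N) (Fin N) ℝ} (F : Frame a1 a2) (l1 l2 : ℝ)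
    (hd : ∀ i, l1 * F.f i + l2 ≠ 0) : IsUnit (l1 • a1 + l2 • a2).det := by
  have hP : F.P.det ≠ 0 := by
    have := congrArg Matrix.det F.hPQ
    rw [Matrix.det_mul, Matrix.det_one] at this
    exact left_ne_zero_of_mul (by rw [this]; exact one_ne_zero)
  rw [F.comb, Matrix.det_mul, Matrix.det_mul, det_diagonal, Matrix.det_transpose,
    isUnit_iff_ne_zero]
  exact mul_ne_zero (mul_ne_zero hP
    (Finset.prod_ne_zero_iff.2 fun i _ => mul_ne_zero (hd i) (F.he0 i))) hP

lemma diag_lc (hU : IsOpen U) (hg1 : IsMetricOn g1 U) (hg2 : IsMetricOn g2 U) (l1 l2 : ℝ)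
    (hu : u ∈ U) (hd : IsUnit (l1 • g1 u + l2 • g2 u).det) (hD : IsDiagAt g1 g2 u) :
    ∃ Y : Fin N → Matrix (Fin N) (Fin N) ℝ,
      (∀ j, GU (fun w => l1 • g1 w + l2 • g2 w) j u = GU g1 j u + l2 • Y j) ∧
      (∀ j, (l1 • g1 u + l2 • g2 u) * Y j = g2 u * (GU g2 j u - GU g1 j u)) ∧
      (∀ j, (Y j)ᵀ = Y j) ∧
      (∀ i j, (Y i * (l1 • g1 u + l2 • g2 u) * Y j)ᵀ =
        Y i * (l1 • g1 u + l2 • g2 u) * Y j) ∧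
      (∀ i j, ((GU g2 i u - GU g1 i u) * g2 u * (GU g2 j u - GU g1 j u))ᵀ =
        (GU g2 i u - GU g1 i u) * g2 u * (GU g2 j u - GU g1 j u)) := by
  obtain ⟨F, d, hF⟩ := hD
  have hm := F.comb_ne l1 l2 hd
  set m : Fin N → ℝ := fun i => (l1 * F.f i + l2) * F.e i with hmdef
  have hgl : l1 • g1 u + l2 • g2 u = F.P * diagonal m * F.Pᵀ := F.comb l1 l2
  set Y : Fin N → Matrix (Fin N) (Fin N) ℝ := fun j =>
    F.Qᵀ * diagonal (fun i => d j i / (l1 * F.f i + l2)) * F.Q with hY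
  have hYs : ∀ j, (Y j)ᵀ = Y j := fun j => F.down_symm _
  have hgY : ∀ j, (l1 • g1 u + l2 • g2 u) * Y j = g2 u * (GU g2 j u - GU g1 j u) := by
    intro j
    rw [hF, hgl, F.up_down]
    rw [F.g2_down]
    congr 3
    ext i
    simp only [hmdef]
    field_simp [hm i]
  have hV := comb_open hU hg1 hg2 l1 l2
  have hgm := comb_metric hg1 hg2 l1 l2
  refine ⟨Y, ?_, hgY, hYs, ?_, ?_⟩
  · intro j
    refine lc_unique hV hgm ⟨hu, hd⟩ (fun j => GU g1 j u + l2 • Y j) ?_ ?_ j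
    · intro j
      simp only [Matrix.transpose_add, Matrix.transpose_smul, hYs, GU_symm hU hg1 hu]
    · intro k i j
      have hC : ∀ j, (l1 • g1 u + l2 • g2 u) * (GU g1 j u + l2 • Y j) =
          l1 • (g1 u * GU g1 j u) + l2 • (g2 u * GU g2 j u) := by
        intro j
        rw [Matrix.mul_add, Matrix.mul_smul, hgY]
        simp only [Matrix.add_mul, Matrix.smul_mul, Matrix.mul_sub, smul_sub]
        abel
      simp only [hC]
      have e1 : pd (fun w => (l1 • g1 w + l2 • g2 w) i j) k u =
          l1 * pd (fun w => g1 w i j) k u + l2 * pd (fun w => g2 w i j) k u := by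
        have a1 := metric_diff hU hg1 hu i j
        have a2 := metric_diff hU hg2 hu i j
        rw [← pd_const_mul k l1 a1, ← pd_const_mul k l2 a2,
          ← pd_add k (a1.const_mul l1) (a2.const_mul l2)]
        rfl
      rw [e1, metric_compat' hU hg1 hu, metric_compat' hU hg2 hu]
      simp only [Matrix.add_apply, Matrix.smul_apply, smul_eq_mul]
      ring
  · intro i j
    rw [Matrix.mul_assoc, hgl, hY]
    simp only
    rw [F.up_down, F.down_mix, F.down_symm]
  · intro i j
    rw [Matrix.mul_assoc, hF, hF]
    rw [F.g2_down, F.down_mix, F.down_symm]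

lemma diag_ac_pt (hU : IsOpen U) (hg1 : IsMetricOn g1 U) (hg2 : IsMetricOn g2 U) (l1 l2 : ℝ)
    (hu : u ∈ U) (hd : IsUnit (l1 • g1 u + l2 • g2 u).det) (hD : IsDiagAt g1 g2 u)
    (i j k : Fin N) :
    christoffelR (fun v => l1 • g1 v + l2 • g2 v) i j k u =
      l1 * christoffelR g1 i j k u + l2 * christoffelR g2 i j k u := by
  obtain ⟨Y, h1, h2, -⟩ := diag_lc hU hg1 hg2 l1 l2 hu hd hD
  rw [christoffelR_eq, christoffelR_eq, christoffelR_eq, h1, Matrix.mul_add, Matrix.mul_smul, h2]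
  simp only [Matrix.add_mul, Matrix.smul_mul, Matrix.mul_sub, smul_sub, Matrix.add_apply,
    Matrix.sub_apply, Matrix.smul_apply, smul_eq_mul]
  ring

lemma diag_curv (hU : IsOpen U) (hg1 : IsMetricOn g1 U) (hg2 : IsMetricOn g2 U) (l1 l2 : ℝ)
    (hu : u ∈ U) (hd : IsUnit (l1 • g1 u + l2 • g2 u).det) (hD : ∀ w ∈ U, IsDiagAt g1 g2 w)
    (i j k l : Fin N) :
    curvatureR (fun v => l1 • g1 v + l2 • g2 v) i j k l u =
      l1 * curvatureR g1 i j k l u + l2 * curvatureR g2 i j k l u := by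
  have hV := comb_open hU hg1 hg2 l1 l2
  have hgm := comb_metric hg1 hg2 l1 l2
  have hR : ∀ {g : MetF N} (_ : IsMetricOn g U) (i j l), DifferentiableAt ℝ (christoffelR g i j l) u := by
    intro g hg i j l
    exact DifferentiableAt.fun_sum fun s _ => (metric_diff hU hg hu i s).fun_mul
      (christoffel_diff hU hg hu j s l)
  have hp : ∀ k l, pd (christoffelR (fun v => l1 • g1 v + l2 • g2 v) i j l) k u =
      l1 * pd (christoffelR g1 i j l) k u + l2 * pd (christoffelR g2 i j l) k u := by
    intro k l
    rw [← pd_const_mul k l1 (hR hg1 i j l), ← pd_const_mul k l2 (hR hg2 i j l),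
      ← pd_add k ((hR hg1 i j l).const_mul l1) ((hR hg2 i j l).const_mul l2)]
    refine pd_congr k ?_
    filter_upwards [hV.mem_nhds ⟨hu, hd⟩] with w hw
    exact diag_ac_pt hU hg1 hg2 l1 l2 hw.1 hw.2 (hD w hw.1) i j l
  rw [curvatureR_eq hV hgm ⟨hu, hd⟩, curvatureR_eq hU hg1 hu, curvatureR_eq hU hg2 hu, hp, hp]
  obtain ⟨Y, h1, h2, h3, h4, h5⟩ := diag_lc hU hg1 hg2 l1 l2 hu hd (hD u hu)
  have h2' : Y i * (l1 • g1 u + l2 • g2 u) = (GU g2 i u - GU g1 i u) * g2 u := by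
    have := congrArg Matrix.transpose (h2 i)
    have hs : (l1 • g1 u + l2 • g2 u)ᵀ = l1 • g1 u + l2 • g2 u := hgm.2.1 u ⟨hu, hd⟩
    rw [Matrix.transpose_mul, Matrix.transpose_mul, h3, hs, Matrix.transpose_sub,
      GU_symm hU hg1 hu, GU_symm hU hg2 hu, (hg2.2.1 u hu).eq] at this
    exact this
  set S := l2 • l2 • (Y i * (l1 • g1 u + l2 • g2 u) * Y j) -
    l2 • ((GU g2 i u - GU g1 i u) * g2 u * (GU g2 j u - GU g1 j u)) with hS
  have hSs : Sᵀ = S := by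
    rw [hS, Matrix.transpose_sub, Matrix.transpose_smul, Matrix.transpose_smul,
      Matrix.transpose_smul, h4, h5]
  have key : (GU g1 i u + l2 • Y i) * (l1 • g1 u + l2 • g2 u) * (GU g1 j u + l2 • Y j) =
      l1 • (GU g1 i u * g1 u * GU g1 j u) + l2 • (GU g2 i u * g2 u * GU g2 j u) + S := by
    have a : (GU g1 i u + l2 • Y i) * (l1 • g1 u + l2 • g2 u) * (GU g1 j u + l2 • Y j) =
      GU g1 i u * (l1 • g1 u + l2 • g2 u) * GU g1 j u
      + l2 • ((Y i * (l1 • g1 u + l2 • g2 u)) * GU g1 j u)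
      + l2 • (GU g1 i u * ((l1 • g1 u + l2 • g2 u) * Y j))
      + l2 • l2 • (Y i * (l1 • g1 u + l2 • g2 u) * Y j) := by
      generalize l1 • g1 u + l2 • g2 u = G
      simp only [Matrix.add_mul, Matrix.mul_add, Matrix.smul_mul, Matrix.mul_smul,
        Matrix.mul_assoc, smul_add]
      abel
    rw [a, hS]
    generalize l2 • l2 • (Y i * (l1 • g1 u + l2 • g2 u) * Y j) = Z
    rw [h2', h2]
    simp only [Matrix.add_mul, Matrix.mul_add, Matrix.sub_mul, Matrix.mul_sub, Matrix.smul_mul,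
        Matrix.mul_smul, Matrix.mul_assoc, smul_sub]
    abel
  rw [h1, h1, key]
  have hkl : S k l = S l k := (congrFun (congrFun hSs l) k).symm ▸ rfl
  simp only [Matrix.add_apply, Matrix.smul_apply, smul_eq_mul]
  rw [hkl]
  ring

lemma Frame.isDiag_of_offdiag (F : Frame (g1 u) (g2 u))
    (h : ∀ j a b, a ≠ b → (F.Pᵀ * (GU g2 j u - GU g1 j u) * F.P) a b = 0) :
    IsDiagAt g1 g2 u := by
  refine ⟨F, fun j a => (F.Pᵀ * (GU g2 j u - GU g1 j u) * F.P) a a, fun j => ?_⟩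
  have : diagonal (fun a => (F.Pᵀ * (GU g2 j u - GU g1 j u) * F.P) a a) =
      F.Pᵀ * (GU g2 j u - GU g1 j u) * F.P := by
    ext a b
    by_cases hab : a = b
    · subst hab; simp
    · rw [diagonal_apply_ne _ hab, h j a b hab]
  rw [this]
  calc _ = (F.Qᵀ * F.Pᵀ) * (GU g2 j u - GU g1 j u) * (F.P * F.Q) := by
        rw [F.hQPt, F.hPQ, Matrix.one_mul, Matrix.mul_one]
    _ = _ := by simp only [Matrix.mul_assoc]

lemma ac_diag (hU : IsOpen U) (hg1 : IsMetricOn g1 U) (hg2 : IsMetricOn g2 U) (hu : u ∈ U)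
    (F : Frame (g1 u) (g2 u)) (hac : AlmostCompatibleOn g1 g2 U) : IsDiagAt g1 g2 u := by
  obtain ⟨l, hl⟩ := Infinite.exists_notMem_finset
    (insert (0 : ℝ) (Finset.univ.image fun i => - F.f i))
  have hl0 : l ≠ 0 := fun h => hl (by simp [h])
  have hlf : ∀ i, F.f i + l ≠ 0 := by
    intro i h
    refine hl (Finset.mem_insert_of_mem (Finset.mem_image.2 ⟨i, Finset.mem_univ i, ?_⟩))
    linarith
  have hd : IsUnit ((1 : ℝ) • g1 u + l • g2 u).det :=
    F.comb_unit 1 l (fun i => by rw [one_mul]; exact hlf i)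
  have hV := comb_open hU hg1 hg2 1 l
  have hgm := comb_metric hg1 hg2 1 l
  refine F.isDiag_of_offdiag fun j a b hab => ?_
  set D := GU g2 j u - GU g1 j u with hDdef
  set T := GU (fun w => (1 : ℝ) • g1 w + l • g2 w) j u - GU g1 j u with hT
  have hDs : Dᵀ = D := by
    rw [hDdef, Matrix.transpose_sub, GU_symm hU hg1 hu, GU_symm hU hg2 hu]
  have hTs : Tᵀ = T := by
    rw [hT, Matrix.transpose_sub, GU_symm hU hg1 hu, GU_symm hV hgm ⟨hu, hd⟩]
  have h1 : ((1 : ℝ) • g1 u + l • g2 u) * T = l • (g2 u * D) := by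
    have : ((1 : ℝ) • g1 u + l • g2 u) * GU (fun w => (1 : ℝ) • g1 w + l • g2 w) j u =
        g1 u * GU g1 j u + l • (g2 u * GU g2 j u) := by
      ext i k
      have := hac 1 l u hu hd i j k
      rw [christoffelR_eq, christoffelR_eq, christoffelR_eq] at this
      simpa using this
    rw [hT, Matrix.mul_sub, this, hDdef]
    simp only [Matrix.add_mul, Matrix.smul_mul, Matrix.mul_sub, smul_sub, one_smul]
    abel
  set X := F.Pᵀ * D * F.P with hX
  set Z := F.Pᵀ * T * F.P with hZ
  have hXs : X b a = X a b := by
    have : Xᵀ = X := by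
      rw [hX, Matrix.transpose_mul, Matrix.transpose_mul, hDs, Matrix.transpose_transpose,
        Matrix.mul_assoc]
    exact congrFun (congrFun this a) b
  have hZs : Z b a = Z a b := by
    have : Zᵀ = Z := by
      rw [hZ, Matrix.transpose_mul, Matrix.transpose_mul, hTs, Matrix.transpose_transpose,
        Matrix.mul_assoc]
    exact congrFun (congrFun this a) b
  have h2 : diagonal (fun i => (1 * F.f i + l) * F.e i) * Z = l • (diagonal F.e * X) := by
    have h3 := congrArg (fun M => F.Q * M * F.P) h1
    rw [F.comb] at h3
    have e2 : F.Q * (l • (g2 u * D)) * F.P =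
        F.Q * (l • ((F.P * diagonal F.e * F.Pᵀ) * D)) * F.P :=
      congrArg (fun M => F.Q * (l • (M * D)) * F.P) F.h2
    rw [e2] at h3
    have e3 : ∀ (M : Matrix (Fin N) (Fin N) ℝ), F.Q * (F.P * M) = M := fun M => by
      rw [← Matrix.mul_assoc, F.hQP, Matrix.one_mul]
    simp only [Matrix.mul_assoc, Matrix.mul_smul, Matrix.smul_mul, e3] at h3
    rw [hX, hZ]
    simp only [Matrix.mul_assoc]
    exact h3
  have h3 : ∀ a b, (F.f a + l) * Z a b = l * X a b := by
    intro a b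
    have := congrFun (congrFun h2 a) b
    rw [diagonal_mul, Matrix.smul_apply, diagonal_mul, smul_eq_mul] at this
    apply mul_left_cancel₀ (F.he0 a)
    linear_combination this
  have ha := h3 a b
  have hb := h3 b a
  rw [hXs, hZs] at hb
  have h4 : (F.f a - F.f b) * Z a b = 0 := by linear_combination ha - hb
  have h5 := (mul_eq_zero.1 h4).resolve_left fun h => hab (F.hf (sub_eq_zero.1 h))
  rw [h5, mul_zero] at ha
  exact (mul_eq_zero.1 ha.symm).resolve_left hl0

end pair

/-! ### The Nijenhuis tensor -/

section nij
variable {N : ℕ} {g1 g2 : MetF N} {U : Set (Fin N → ℝ)} {u : Fin N → ℝ}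

/-- contraction of a matrix-valued covector with a vector -/
noncomputable def lin (A : Fin N → Matrix (Fin N) (Fin N) ℝ) (x : Fin N → ℝ) :
    Matrix (Fin N) (Fin N) ℝ := ∑ s, x s • A s

lemma lin_mulVec (A : Fin N → Matrix (Fin N) (Fin N) ℝ) (x y : Fin N → ℝ) (k : Fin N) :
    (lin A x *ᵥ y) k = ∑ s, ∑ j, x s * A s k j * y j := by
  simp only [lin, Matrix.mulVec, dotProduct, Matrix.sum_apply, Matrix.smul_apply, smul_eq_mul,
    Finset.sum_mul]
  rw [Finset.sum_comm]

lemma lin_smul (A : Fin N → Matrix (Fin N) (Fin N) ℝ) (c : ℝ) (x : Fin N → ℝ) :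
    lin A (c • x) = c • lin A x := by
  simp [lin, Finset.smul_sum, smul_smul]

lemma nij_t1 (M : Matrix (Fin N) (Fin N) ℝ) (V : Fin N → Matrix (Fin N) (Fin N) ℝ)
    (x y : Fin N → ℝ) (k : Fin N) :
    ∑ i, ∑ j, (∑ s, M s i * V s k j) * x i * y j = (lin V (M *ᵥ x) *ᵥ y) k := by
  rw [lin_mulVec]
  simp only [Matrix.mulVec, dotProduct, Finset.sum_mul]
  calc _ = ∑ i, ∑ s, ∑ j, M s i * V s k j * x i * y j :=
        Finset.sum_congr rfl fun i _ => Finset.sum_comm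
    _ = ∑ s, ∑ i, ∑ j, M s i * V s k j * x i * y j := Finset.sum_comm
    _ = _ := by
        refine Finset.sum_congr rfl fun s _ => ?_
        rw [Finset.sum_comm]
        refine Finset.sum_congr rfl fun j _ => Finset.sum_congr rfl fun i _ => ?_
        ring

lemma nij_t2 (M : Matrix (Fin N) (Fin N) ℝ) (V : Fin N → Matrix (Fin N) (Fin N) ℝ)
    (x y : Fin N → ℝ) (k : Fin N) :
    ∑ i, ∑ j, (∑ s, M k s * V j s i) * x i * y j = (M *ᵥ (lin V y *ᵥ x)) k := by
  have : (M *ᵥ (lin V y *ᵥ x)) k = ∑ s, M k s * (lin V y *ᵥ x) s := rfl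
  rw [this]
  simp only [lin_mulVec, Finset.sum_mul, Finset.mul_sum]
  calc _ = ∑ i, ∑ s, ∑ j, M k s * V j s i * x i * y j :=
        Finset.sum_congr rfl fun i _ => Finset.sum_comm
    _ = ∑ s, ∑ i, ∑ j, M k s * V j s i * x i * y j := Finset.sum_comm
    _ = _ := by
        refine Finset.sum_congr rfl fun s _ => ?_
        rw [Finset.sum_comm]
        refine Finset.sum_congr rfl fun j _ => Finset.sum_congr rfl fun i _ => ?_
        ring

lemma nij_expand (v : MetF N) (x y : Fin N → ℝ) (k : Fin N) :
    ∑ i, ∑ j, nijenhuisT v k i j u * x i * y j =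
      (lin (fun s => pdM v s u) (v u *ᵥ x) *ᵥ y - lin (fun s => pdM v s u) (v u *ᵥ y) *ᵥ x
        + v u *ᵥ (lin (fun s => pdM v s u) y *ᵥ x)
        - v u *ᵥ (lin (fun s => pdM v s u) x *ᵥ y)) k := by
  simp only [Pi.sub_apply, Pi.add_apply]
  rw [← nij_t1, ← nij_t1, ← nij_t2, ← nij_t2,
    Finset.sum_comm (f := fun i j => (∑ s, v u s i * (fun s => pdM v s u) s k j) * y i * x j),
    Finset.sum_comm (f := fun i j => (∑ s, v u k s * (fun s => pdM v s u) j s i) * y i * x j),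
    ← Finset.sum_sub_distrib, ← Finset.sum_add_distrib, ← Finset.sum_sub_distrib]
  refine Finset.sum_congr rfl fun i _ => ?_
  rw [← Finset.sum_sub_distrib, ← Finset.sum_add_distrib, ← Finset.sum_sub_distrib]
  refine Finset.sum_congr rfl fun j _ => ?_
  simp only [nijenhuisT, Finset.sum_sub_distrib, Finset.sum_add_distrib, pdM, Matrix.of_apply]
  ring

lemma GLo_lin_symm (hU : IsOpen U) (hg : IsMetricOn g2 U) (hu : u ∈ U) (x y : Fin N → ℝ) :
    lin (fun s => GLo g2 s u) x *ᵥ y = lin (fun s => GLo g2 s u) y *ᵥ x := by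
  ext k
  rw [lin_mulVec, lin_mulVec, Finset.sum_comm]
  refine Finset.sum_congr rfl fun s _ => Finset.sum_congr rfl fun j _ => ?_
  simp only [GLo, Matrix.of_apply]
  rw [christoffel_symm hU hg hu k s j]
  ring

lemma pdM_aff (hU : IsOpen U) (hg1 : IsMetricOn g1 U) (hg2 : IsMetricOn g2 U) (hu : u ∈ U)
    (k : Fin N) :
    pdM (fun w => g1 w * (g2 w)⁻¹) k u =
      ((GLo g2 k u - GLo g1 k u) * (g1 u * (g2 u)⁻¹)
        + g1 u * (GLo g2 k u - GLo g1 k u)ᵀ * (g2 u)⁻¹)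
      - (GLo g2 k u * (g1 u * (g2 u)⁻¹) - (g1 u * (g2 u)⁻¹) * GLo g2 k u) := by
  rw [pdM_mul k (metric_diff hU hg1 hu) (inv_diff hU hg2 hu), metric_compat hU hg1 hu]
  have hd := hg2.2.2 u hu
  have hi : pdM (fun w => (g2 w)⁻¹) k u = - ((g2 u)⁻¹ * pdM g2 k u * (g2 u)⁻¹) := by
    rw [pdM_inv hU hg2 hu]
    simp only [Matrix.mul_neg, Matrix.neg_mul, neg_neg]
    rw [Matrix.mul_assoc, Matrix.mul_assoc (g2 u * _), Matrix.mul_nonsing_inv _ hd,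
      Matrix.mul_one, ← Matrix.mul_assoc, Matrix.nonsing_inv_mul _ hd, Matrix.one_mul]
  rw [hi, metric_compat hU hg2 hu]
  have c1 : ∀ M : Matrix (Fin N) (Fin N) ℝ, (g2 u)⁻¹ * (g2 u * M) = M := fun M => by
    rw [← Matrix.mul_assoc, Matrix.nonsing_inv_mul _ hd, Matrix.one_mul]
  simp only [Matrix.mul_neg, Matrix.neg_mul, Matrix.mul_add, Matrix.add_mul, Matrix.mul_sub,
    Matrix.sub_mul, Matrix.transpose_sub, Matrix.mul_assoc, c1, Matrix.mul_nonsing_inv _ hd,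
    Matrix.mul_one]
  abel

lemma nij_diag (hU : IsOpen U) (hg1 : IsMetricOn g1 U) (hg2 : IsMetricOn g2 U) (hu : u ∈ U)
    (F : Frame (g1 u) (g2 u))
    (hn : ∀ k i j : Fin N, nijenhuisT (fun w => g1 w * (g2 w)⁻¹) k i j u = 0) :
    IsDiagAt g1 g2 u := by
  set v := g1 u * (g2 u)⁻¹ with hv
  set D : Fin N → Matrix (Fin N) (Fin N) ℝ := fun k => GLo g2 k u - GLo g1 k u with hD
  set G : (Fin N → ℝ) → Matrix (Fin N) (Fin N) ℝ := fun x => lin (fun s => GLo g2 s u) x with hG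
  set W : (Fin N → ℝ) → Matrix (Fin N) (Fin N) ℝ := fun x =>
    lin D x * v + g1 u * (lin D x)ᵀ * (g2 u)⁻¹ with hW
  have hGs : ∀ x y, G x *ᵥ y = G y *ᵥ x := GLo_lin_symm hU hg2 hu
  have hV : ∀ x, lin (fun s => pdM (fun w => g1 w * (g2 w)⁻¹) s u) x =
      W x - (G x * v - v * G x) := by
    intro x
    simp only [hW, hG, lin, pdM_aff hU hg1 hg2 hu, Matrix.transpose_sum, Matrix.sum_mul,
      Matrix.mul_sum, ← Finset.sum_sub_distrib, ← Finset.sum_add_distrib]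
    refine Finset.sum_congr rfl fun s _ => ?_
    simp only [hD, ← hv, Matrix.transpose_smul, Matrix.smul_mul, Matrix.mul_smul]
    rw [smul_sub, smul_add, smul_sub]
  have hWs : ∀ (c : ℝ) x, W (c • x) = c • W x := by
    intro c x
    simp only [hW, lin_smul, Matrix.transpose_smul, Matrix.smul_mul, Matrix.mul_smul, smul_add]
  have hN : ∀ x y, W (v *ᵥ x) *ᵥ y - W (v *ᵥ y) *ᵥ x + v *ᵥ (W y *ᵥ x) - v *ᵥ (W x *ᵥ y) = 0 := by
    intro x y
    have h0 : lin (fun s => pdM (fun w => g1 w * (g2 w)⁻¹) s u) (v *ᵥ x) *ᵥ y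
        - lin (fun s => pdM (fun w => g1 w * (g2 w)⁻¹) s u) (v *ᵥ y) *ᵥ x
        + v *ᵥ (lin (fun s => pdM (fun w => g1 w * (g2 w)⁻¹) s u) y *ᵥ x)
        - v *ᵥ (lin (fun s => pdM (fun w => g1 w * (g2 w)⁻¹) s u) x *ᵥ y) = 0 := by
      ext k
      rw [← nij_expand (fun w => g1 w * (g2 w)⁻¹) x y k]
      simp [hn]
    rw [hV, hV, hV, hV] at h0
    simp only [Matrix.sub_mulVec, ← Matrix.mulVec_mulVec, Matrix.mulVec_sub] at h0
    rw [hGs (v *ᵥ x) (v *ᵥ y), hGs (v *ᵥ x) y, hGs (v *ᵥ y) x, hGs x y] at h0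
    rw [← h0]
    abel
  -- frame
  have hg2i : (g2 u)⁻¹ = F.Qᵀ * diagonal (fun i => (F.e i)⁻¹) * F.Q := by
    refine Matrix.inv_eq_right_inv ?_
    rw [F.g2_down]
    have : diagonal (fun i => F.e i * (F.e i)⁻¹) = (1 : Matrix (Fin N) (Fin N) ℝ) := by
      rw [← diagonal_one]; congr 1; ext i; exact mul_inv_cancel₀ (F.he0 i)
    rw [this, Matrix.mul_one, F.hPQ]
  have hvF : v = F.P * diagonal F.f * F.Q := by
    have h1 : v = (F.P * diagonal (fun i => F.f i * F.e i) * F.Pᵀ) * (g2 u)⁻¹ :=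
      congrArg (fun M => M * (g2 u)⁻¹) F.h1
    rw [h1, hg2i, F.up_down]
    congr 3
    ext i
    field_simp [F.he0 i]
  have hvP : ∀ c, v *ᵥ (F.P.col c) = F.f c • F.P.col c := by
    intro c
    have h1 : v * F.P = F.P * diagonal F.f := by
      rw [hvF, Matrix.mul_assoc, F.hQP, Matrix.mul_one]
    ext a
    have h2 := congrFun (congrFun h1 a) c
    rw [mul_diagonal] at h2
    simp only [Pi.smul_apply, smul_eq_mul, Matrix.col_apply]
    rw [mul_comm, ← h2]
    rfl
  have hQv : F.Q * v = diagonal F.f * F.Q := by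
    rw [hvF, ← Matrix.mul_assoc, ← Matrix.mul_assoc, F.hQP, Matrix.one_mul]
  set d : Fin N → Fin N → Fin N → ℝ := fun k c j =>
    (F.Q * lin D (F.P.col c) * F.P) k j with hd
  set w : Fin N → Fin N → Fin N → ℝ := fun k c j =>
    (F.Q * W (F.P.col c) * F.P) k j with hw
  have hcol : ∀ (A : Matrix (Fin N) (Fin N) ℝ) (k j : Fin N),
      (F.Q * A * F.P) k j = (F.Q *ᵥ (A *ᵥ F.P.col j)) k := by
    intro A k j
    rw [Matrix.mulVec_mulVec]; rfl
  have hds : ∀ k c j, d k c j = d k j c := by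
    intro k c j
    simp only [hd]
    rw [hcol, hcol]
    have : ∀ x y, lin D x *ᵥ y = lin D y *ᵥ x := by
      intro x y
      have e : ∀ x, lin D x = lin (fun s => GLo g2 s u) x - lin (fun s => GLo g1 s u) x := by
        intro x
        simp only [lin, hD, smul_sub, Finset.sum_sub_distrib]
      rw [e, e, Matrix.sub_mulVec, Matrix.sub_mulVec, GLo_lin_symm hU hg2 hu,
        GLo_lin_symm hU hg1 hu x y]
    rw [this]
  have hww : ∀ k c j, w k c j = d k c j * F.f j + F.f k * F.e k * d j c k * (F.e j)⁻¹ := by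
    intro k c j
    have h1 : F.Q * W (F.P.col c) * F.P = (F.Q * lin D (F.P.col c) * F.P) * diagonal F.f +
        diagonal (fun i => F.f i * F.e i) * (F.Q * lin D (F.P.col c) * F.P)ᵀ
          * diagonal (fun i => (F.e i)⁻¹) := by
      generalize hA : lin D (F.P.col c) = A
      have e1 : g1 u * Aᵀ * (g2 u)⁻¹ = (F.P * diagonal (fun i => F.f i * F.e i) * F.Pᵀ) * Aᵀ *
          (F.Qᵀ * diagonal (fun i => (F.e i)⁻¹) * F.Q) := by
        rw [hg2i]
        exact congrArg (fun M => M * Aᵀ * (F.Qᵀ * diagonal (fun i => (F.e i)⁻¹) * F.Q)) F.h1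
      have e0 : W (F.P.col c) = A * (F.P * diagonal F.f * F.Q) +
          (F.P * diagonal (fun i => F.f i * F.e i) * F.Pᵀ) * Aᵀ *
          (F.Qᵀ * diagonal (fun i => (F.e i)⁻¹) * F.Q) := by
        simp only [hW, hA]
        rw [e1, hvF]
      have e3 : ∀ (M : Matrix (Fin N) (Fin N) ℝ), F.Q * (F.P * M) = M := fun M => by
        rw [← Matrix.mul_assoc, F.hQP, Matrix.one_mul]
      rw [e0]
      simp only [Matrix.mul_add, Matrix.add_mul, Matrix.mul_assoc, Matrix.transpose_mul, e3,
        F.hQP, Matrix.mul_one]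
    simp only [hw, hd]
    rw [h1, Matrix.add_apply, mul_diagonal, mul_diagonal, diagonal_mul, Matrix.transpose_apply]
  have hnn : ∀ k c j, (F.f c - F.f k) * w k c j = (F.f j - F.f k) * w k j c := by
    intro k c j
    have h1 := hN (F.P.col c) (F.P.col j)
    rw [hvP, hvP, hWs, hWs, Matrix.smul_mulVec, Matrix.smul_mulVec] at h1
    have h2 := congrFun (congrArg (fun z => F.Q *ᵥ z) h1) k
    simp only [Matrix.mulVec_sub, Matrix.mulVec_add, Matrix.mulVec_smul, Matrix.mulVec_zero] at h2
    rw [Matrix.mulVec_mulVec _ F.Q v, Matrix.mulVec_mulVec _ F.Q v, hQv,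
      ← Matrix.mulVec_mulVec, ← Matrix.mulVec_mulVec] at h2
    simp only [Pi.sub_apply, Pi.add_apply, Pi.smul_apply, smul_eq_mul, Matrix.mulVec_diagonal,
      Pi.zero_apply, ← hcol] at h2
    simp only [hw]
    linear_combination h2
  have hz := scalar_key F.f F.e F.hf F.hf0 F.he0 d hds w hww hnn
  refine F.isDiag_of_offdiag fun j a b hab => ?_
  -- `P` applied to the frame components recovers the coordinate components
  have h1 : ∀ j, (F.Pᵀ * (GU g2 j u - GU g1 j u) * F.P) a b = (lin D (F.P.col b) *ᵥ F.P.col a) j := by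
    intro j
    rw [lin_mulVec, Matrix.mul_apply]
    refine Finset.sum_congr rfl fun s _ => ?_
    rw [Matrix.mul_apply, Finset.sum_mul]
    refine Finset.sum_congr rfl fun t _ => ?_
    simp only [hD, GU, GLo, Matrix.sub_apply, Matrix.of_apply, Matrix.transpose_apply,
      Matrix.col_apply]
    ring
  rw [h1]
  have h2 : F.Q *ᵥ (lin D (F.P.col b) *ᵥ F.P.col a) = 0 := by
    ext k
    rw [← hcol]
    exact hz k b a (Ne.symm hab)
  have h3 := congrArg (fun z => F.P *ᵥ z) h2
  simp only [Matrix.mulVec_zero] at h3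
  rw [Matrix.mulVec_mulVec, F.hPQ, Matrix.one_mulVec] at h3
  rw [h3]
  rfl

end nij

/-- **Theorem 2.** For a non-singular pair of metrics, vanishing of the Nijenhuis tensor of the
affinor `v^i_j = Σ_s g1^{is} (g2)_{sj}` implies compatibility; in particular, a non-singular pair
of metrics is compatible iff it is almost compatible. -/
theorem nonsingular_compatible_iff_almostCompatible {N : ℕ}
    (U : Set (Fin N → ℝ)) (hU : IsOpen U)
    (g1 g2 : MetF N) (hg1 : IsMetricOn g1 U) (hg2 : IsMetricOn g2 U)
    (hns : NonSingularPairOn g1 g2 U) :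
    ((∀ u ∈ U, ∀ k i j : Fin N, nijenhuisT (fun w => g1 w * (g2 w)⁻¹) k i j u = 0) →
        CompatibleOn g1 g2 U) ∧
      (CompatibleOn g1 g2 U ↔ AlmostCompatibleOn g1 g2 U) := by
  have hF : ∀ u ∈ U, Nonempty (Frame (g1 u) (g2 u)) := by
    intro u hu
    obtain ⟨f, hf, hc⟩ := hns u hu
    exact exists_frame _ _ (hg1.2.1 u hu) (hg2.2.1 u hu) (hg1.2.2 u hu) (hg2.2.2 u hu) f hf hc
  have main : (∀ u ∈ U, IsDiagAt g1 g2 u) → CompatibleOn g1 g2 U := by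
    intro hD
    refine ⟨fun l1 l2 u hu hd i j k => ?_, fun l1 l2 u hu hd i j k l => ?_⟩
    · exact diag_ac_pt hU hg1 hg2 l1 l2 hu hd (hD u hu) i j k
    · exact diag_curv hU hg1 hg2 l1 l2 hu hd hD i j k l
  refine ⟨fun hn => main fun u hu => ?_, fun h => h.1, fun hac => main fun u hu => ?_⟩
  · obtain ⟨F⟩ := hF u hu
    exact nij_diag hU hg1 hg2 hu F (hn u hu)
  · obtain ⟨F⟩ := hF u hu
    exact ac_diag hU hg1 hg2 hu F hac
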